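/- arXiv:1909.13173 — 2 statements merged into one kernel-verified Lean document; each statement's English description precedes it below -/
import Mathlib

section
/- Let p be an odd prime and r an integer with r ≥ 2. Then F(p^r−1, p^r−1) ≡ 0 (mod p^{r+2}), where F(n,k) = (−1)^{n+k} (4n−1) · (−1/2)_n² · (−1/2)_{n+k} / ((n!)² · (n−k)! · (−1/2)_k²). Equivalently, (4p^r−5) · (−1/2)_{2p^r−2} / ((p^r−1)!)² ≡ 0 (mod p^{r+2}). -/
open Finset

/-- `a ≡ b (mod p^m)` for rationals: the `p`-adic valuation of `a - b` is at least `m`. -/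
def pcong (p m : ℕ) (a b : ℚ) : Prop :=
  a = b ∨ (m : ℤ) ≤ padicValRat p (a - b)

/-- The rising factorial `(a)_n = a(a+1)⋯(a+n-1)`. -/
noncomputable def rf (a : ℚ) (n : ℕ) : ℚ := (ascPochhammer ℚ n).eval a

/-- `F(n,k) = (−1)^{n+k} (4n−1) · (−1/2)_n² · (−1/2)_{n+k} / ((n!)² · (n−k)! · (−1/2)_k²)`. -/
noncomputable def F (n k : ℕ) : ℚ :=
  (-1) ^ (n + k) * (4 * (n : ℚ) - 1) * (rf (-1/2) n) ^ 2 * rf (-1/2) (n + k) /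
    ((n.factorial : ℚ) ^ 2 * ((n - k).factorial : ℚ) * (rf (-1/2) k) ^ 2)

theorem rf_neg_half_mul (k : ℕ) :
    rf (-1/2) k * (2 * k - 1) = -(k.centralBinom * k.factorial / 4 ^ k) := by
  induction k with
  | zero => simp [rf]
  | succ k ih =>
    have hrec : ((k : ℚ) + 1) * (k + 1).centralBinom = 2 * (2 * k + 1) * k.centralBinom := by
      exact_mod_cast Nat.succ_mul_centralBinom_succ k
    have hrf : rf (-1/2) (k + 1) = rf (-1/2) k * (-1/2 + k) := ascPochhammer_succ_eval k _
    calc rf (-1/2) (k + 1) * (2 * (k + 1 : ℕ) - 1)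
        = rf (-1/2) k * (2 * k - 1) * (2 * k + 1) / 2 := by rw [hrf]; push_cast; ring
      _ = -(2 * (2 * k + 1) * k.centralBinom * k.factorial / 4 ^ (k + 1)) := by
        rw [ih, pow_succ]; ring
      _ = _ := by rw [← hrec, Nat.factorial_succ]; push_cast; ring

theorem rf_neg_half_ne_zero (k : ℕ) : rf (-1/2) k ≠ 0 := by
  intro h
  have hk := rf_neg_half_mul k
  rw [h, zero_mul, eq_comm, neg_eq_zero] at hk
  have hb : (k.centralBinom : ℚ) ≠ 0 := by exact_mod_cast k.centralBinom_ne_zero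
  have hf : (k.factorial : ℚ) ≠ 0 := by exact_mod_cast k.factorial_ne_zero
  exact div_ne_zero (mul_ne_zero hb hf) (by positivity) hk

theorem F_self (n : ℕ) :
    F n n = -(((2 * n).centralBinom * n.centralBinom : ℕ) / (16 ^ n : ℕ)) := by
  have h := rf_neg_half_mul (2 * n)
  have hn : (n.factorial : ℚ) ≠ 0 := by exact_mod_cast n.factorial_ne_zero
  have hfac : ((2 * n).factorial : ℚ) = n.centralBinom * n.factorial ^ 2 := by
    have := Nat.choose_mul_factorial_mul_factorial (show n ≤ 2 * n by omega)
    rw [show 2 * n - n = n by omega, ← Nat.centralBinom_eq_two_mul_choose] at this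
    rw [← this]; push_cast; ring
  have hr := rf_neg_half_ne_zero n
  have hpow : (4 : ℚ) ^ (2 * n) = 16 ^ n := by rw [pow_mul]; norm_num
  have hsign : (-1 : ℚ) ^ (n + n) = 1 := by rw [← two_mul, pow_mul]; norm_num
  calc F n n = rf (-1/2) (2 * n) * (2 * (2 * n : ℕ) - 1) / n.factorial ^ 2 := by
        rw [F, hsign, ← two_mul, Nat.sub_self]
        push_cast [Nat.factorial_zero]
        generalize rf (-1/2) n = a at hr ⊢
        field_simp
        ring
    _ = _ := by
        rw [h, hfac, hpow]
        push_cast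
        field_simp

/-- `n + 1` divides `2 (2n + 1) * centralBinom n`, and `2n + 1` is prime to `n + 1`. -/
theorem dvd_centralBinom_of_add_one {q n : ℕ} (hq : Odd q) (hn : n + 1 = q) :
    q ∣ n.centralBinom := by
  have hrec := Nat.succ_mul_centralBinom_succ n
  have hdvd : q ∣ 2 * (2 * n + 1) * n.centralBinom := ⟨_, by rw [← hrec, hn]⟩
  refine (Nat.Coprime.mul_right (Nat.coprime_two_right.mpr hq) ?_).dvd_of_dvd_mul_left hdvd
  rw [← Nat.isCoprime_iff_coprime]
  exact ⟨2, -1, by rw [← hn]; push_cast; ring⟩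

/-- The factor `3` compensates for a possible common factor of `q` and `4q - 3`. -/
theorem dvd_three_mul_centralBinom_two_mul {q n : ℕ} (hq : Odd q) (hn : n + 1 = q) :
    q ∣ 3 * (2 * n).centralBinom := by
  have h₁ := Nat.succ_mul_centralBinom_succ (2 * n)
  have h₂ := Nat.succ_mul_centralBinom_succ (2 * n + 1)
  have hprod : 4 * (4 * n + 3) * ((4 * n + 1) * (2 * n).centralBinom) =
      q * (2 * (2 * n + 1) * (2 * n + 1 + 1).centralBinom) := by
    rw [← hn]
    linarith [congrArg (fun t => (2 * n + 1) * t) h₂, congrArg (fun t => 2 * (4 * n + 3) * t) h₁]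
  have hcop : Nat.Coprime q (4 * (4 * n + 3)) := by
    refine Nat.Coprime.mul_right (Nat.Coprime.pow_right 2 (Nat.coprime_two_right.mpr hq)) ?_
    rw [← Nat.isCoprime_iff_coprime]
    exact ⟨4, -1, by rw [← hn]; push_cast; ring⟩
  have hdvd : q ∣ (4 * n + 1) * (2 * n).centralBinom :=
    hcop.dvd_of_dvd_mul_left ⟨_, hprod⟩
  refine (Nat.dvd_add_right hdvd).mp ⟨4 * (2 * n).centralBinom, ?_⟩
  rw [← hn]
  ring

theorem pow_dvd_centralBinom_mul_centralBinom {p r n : ℕ} (hp : p.Prime) (hodd : Odd p)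
    (hr : 2 ≤ r) (hn : n + 1 = p ^ r) :
    p ^ (r + 2) ∣ (2 * n).centralBinom * n.centralBinom := by
  have h₁ := dvd_centralBinom_of_add_one hodd.pow hn
  have h₂ := dvd_three_mul_centralBinom_two_mul hodd.pow hn
  by_cases h3 : p = 3
  · subst h3
    obtain rfl | hr' := hr.eq_or_lt
    · obtain rfl : n = 8 := by omega
      rw [pow_add]
      refine mul_dvd_mul ?_ h₁
      norm_num [Nat.centralBinom, Nat.choose]
    · obtain ⟨s, rfl⟩ : ∃ s, r = s + 1 := ⟨r - 1, by omega⟩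
      rw [pow_succ', Nat.mul_dvd_mul_iff_left (by norm_num)] at h₂
      refine (pow_dvd_pow 3 (show s + 1 + 2 ≤ s + (s + 1) by omega)).trans ?_
      rw [pow_add]
      exact mul_dvd_mul h₂ h₁
  · have hcop : Nat.Coprime (p ^ r) 3 :=
      Nat.Coprime.pow_left r ((Nat.coprime_primes hp Nat.prime_three).mpr h3)
    refine (pow_dvd_pow p (show r + 2 ≤ r + r by omega)).trans ?_
    rw [pow_add]
    exact mul_dvd_mul (hcop.dvd_of_dvd_mul_left h₂) h₁

theorem stmt_13 (p : ℕ) (hp : p.Prime) (hodd : Odd p) (r : ℕ) (hr : 2 ≤ r) :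
    pcong p (r + 2) (F (p ^ r - 1) (p ^ r - 1)) 0 := by
  have : Fact p.Prime := ⟨hp⟩
  have hn : p ^ r - 1 + 1 = p ^ r := Nat.sub_add_cancel (Nat.pos_of_ne_zero (by simp [hp.ne_zero]))
  generalize p ^ r - 1 = n at hn ⊢
  have hne : (2 * n).centralBinom * n.centralBinom ≠ 0 :=
    mul_ne_zero (Nat.centralBinom_ne_zero _) (Nat.centralBinom_ne_zero _)
  have hle := (padicValNat_dvd_iff_le hne).mp
    (pow_dvd_centralBinom_mul_centralBinom hp hodd hr hn)
  have h16 : padicValNat p (16 ^ n) = 0 := by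
    refine padicValNat.eq_zero_of_not_dvd ((Nat.Prime.coprime_iff_not_dvd hp).mp ?_)
    exact Nat.Coprime.pow_right n (Nat.Coprime.pow_right 4 (Nat.coprime_two_right.mpr hodd))
  right
  rw [sub_zero, F_self, padicValRat.neg, padicValRat.div (by exact_mod_cast hne) (by positivity),
    padicValRat.of_nat, padicValRat.of_nat, h16, Nat.cast_zero, sub_zero]
  exact_mod_cast hle
end

section
/- Let p be a prime with p > 3 and r an integer with r ≥ 2. Then G(p^r, (p^r+1)/2) ≡ (−1)^{(p^r−1)/2} · 3·p^r · (1 − 5p·q_p(2)) (mod p^{r+2}), where G(n,k) = ((−1)^{n+k} / 4^{5n−4−k}) · n · C(2n−1, n−1) · C(2(2n−1+k), 2n−1+k) · C(2n−1+k, 2k) · C(2n−1−k, n−1) / C(2k,k). -/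
open Finset

/-- \`G(n,k) = ((−1)^{n+k}/4^{5n−4−k}) · n · C(2n−1,n−1) · C(2(2n−1+k),2n−1+k) · C(2n−1+k,2k) · C(2n−1−k,n−1) / C(2k,k)\`. -/
def G (n k : ℕ) : ℚ :=
  (-1) ^ (n + k) / 4 ^ (5 * n - 4 - k) * (n : ℚ) * (((2 * n - 1).choose (n - 1) : ℕ) : ℚ) *
    (((2 * (2 * n - 1 + k)).choose (2 * n - 1 + k) : ℕ) : ℚ) *
    (((2 * n - 1 + k).choose (2 * k) : ℕ) : ℚ) *
    (((2 * n - 1 - k).choose (n - 1) : ℕ) : ℚ) / (((2 * k).choose k : ℕ) : ℚ)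

/-- `x` lies in `p ℤ_(p)`. -/
def IsPMultiple (p : ℕ) (x : ℚ) : Prop :=
  ∃ a b : ℤ, ¬ (p : ℤ) ∣ b ∧ x = p * a / b

/-- `x` lies in the unit group `1 + p² ℤ_(p)`. -/
def IsOneModSq (p : ℕ) (x : ℚ) : Prop :=
  ∃ a b : ℤ, ¬ (p : ℤ) ∣ b ∧ x = 1 + p ^ 2 * a / b

/-- The product of the first `k` odd numbers. -/
def oddProd (k : ℕ) : ℚ := ∏ i ∈ range k, (2 * (i : ℚ) + 1)

theorem intCast_ne_zero_of_not_dvd {p : ℕ} {b : ℤ} (h : ¬ (p : ℤ) ∣ b) : (b : ℚ) ≠ 0 := by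
  rintro h0
  exact h (by simp [Int.cast_eq_zero.mp h0])

namespace IsPMultiple

variable {p : ℕ} {x y : ℚ}

theorem one_add_mul (hp : p.Prime) (hx : IsPMultiple p x) (hy : IsPMultiple p y) (c : ℤ) :
    IsOneModSq p (1 + c * (x * y)) := by
  obtain ⟨a, b, hb, rfl⟩ := hx
  obtain ⟨a', b', hb', rfl⟩ := hy
  have hp' := Nat.prime_iff_prime_int.mp hp
  refine ⟨c * (a * a'), b * b', fun h => (hp'.dvd_or_dvd h).elim hb hb', ?_⟩
  have := intCast_ne_zero_of_not_dvd hb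
  have := intCast_ne_zero_of_not_dvd hb'
  push_cast
  field_simp

theorem not_dvd_sub {a b : ℤ} (hb : ¬ (p : ℤ) ∣ b) : ¬ (p : ℤ) ∣ b - p * a := fun h =>
  hb (by simpa using dvd_add h (dvd_mul_right (p : ℤ) a))

theorem one_sub_ne_zero (hx : IsPMultiple p x) : 1 - x ≠ 0 := by
  obtain ⟨a, b, hb, rfl⟩ := hx
  have h1 := intCast_ne_zero_of_not_dvd hb
  have h2 := intCast_ne_zero_of_not_dvd (not_dvd_sub (a := a) hb)
  push_cast at h2
  rw [one_sub_div h1]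
  exact div_ne_zero h2 h1

theorem div_one_sub (hx : IsPMultiple p x) : IsPMultiple p (x / (1 - x)) := by
  have h := hx.one_sub_ne_zero
  obtain ⟨a, b, hb, rfl⟩ := hx
  refine ⟨a, b - p * a, not_dvd_sub hb, ?_⟩
  have h1 := intCast_ne_zero_of_not_dvd hb
  have h2 := intCast_ne_zero_of_not_dvd (not_dvd_sub (a := a) hb)
  push_cast at h2 ⊢
  rw [div_eq_div_iff h h2]
  field_simp

theorem pow_div {r j : ℕ} (hp : p.Prime) (hj : 0 < j) (hjr : j < p ^ r) :
    IsPMultiple p ((p : ℚ) ^ r / j) := by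
  obtain ⟨s, b, hb, rfl⟩ := Nat.exists_eq_pow_mul_and_not_dvd hj.ne' p hp.ne_one
  have hb0 : 0 < b := Nat.pos_of_mul_pos_left hj
  have hsr : s < r := by
    by_contra! h
    have h1 := Nat.pow_le_pow_right hp.pos h
    have h2 := Nat.le_mul_of_pos_right (p ^ s) hb0
    omega
  obtain ⟨t, rfl⟩ := Nat.exists_eq_add_of_lt hsr
  refine ⟨p ^ t, b, by exact_mod_cast hb, ?_⟩
  have : (p : ℚ) ≠ 0 := by exact_mod_cast hp.ne_zero
  have : (b : ℚ) ≠ 0 := by exact_mod_cast hb0.ne'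
  push_cast
  field_simp
  ring

end IsPMultiple

namespace IsOneModSq

variable {p : ℕ} {x y : ℚ}

theorem one (hp : p.Prime) : IsOneModSq p 1 :=
  ⟨0, 1, fun h => hp.one_lt.ne' (by exact_mod_cast Int.eq_one_of_dvd_one (by positivity) h),
    by simp⟩

theorem mul (hp : p.Prime) (hx : IsOneModSq p x) (hy : IsOneModSq p y) :
    IsOneModSq p (x * y) := by
  obtain ⟨a, b, hb, rfl⟩ := hx
  obtain ⟨a', b', hb', rfl⟩ := hy
  have hp' := Nat.prime_iff_prime_int.mp hp
  refine ⟨a * b' + a' * b + p ^ 2 * a * a', b * b',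
    fun h => (hp'.dvd_or_dvd h).elim hb hb', ?_⟩
  have := intCast_ne_zero_of_not_dvd hb
  have := intCast_ne_zero_of_not_dvd hb'
  push_cast
  field_simp
  ring

theorem not_dvd_add {a b : ℤ} (hb : ¬ (p : ℤ) ∣ b) : ¬ (p : ℤ) ∣ b + p ^ 2 * a := fun h =>
  hb ((dvd_add_left (Dvd.intro (p * a) (by ring))).mp h)

theorem ne_zero (hx : IsOneModSq p x) : x ≠ 0 := by
  obtain ⟨a, b, hb, rfl⟩ := hx
  have h1 := intCast_ne_zero_of_not_dvd hb
  have h2 := intCast_ne_zero_of_not_dvd (not_dvd_add (a := a) hb)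
  push_cast at h2
  rw [one_add_div h1]
  exact div_ne_zero h2 h1

theorem inv (hx : IsOneModSq p x) : IsOneModSq p x⁻¹ := by
  obtain ⟨a, b, hb, rfl⟩ := hx
  refine ⟨-a, b + p ^ 2 * a, not_dvd_add hb, ?_⟩
  have h1 := intCast_ne_zero_of_not_dvd hb
  have h2 := intCast_ne_zero_of_not_dvd (not_dvd_add (a := a) hb)
  push_cast at h2 ⊢
  rw [one_add_div h1, inv_div]
  field_simp
  ring

theorem pow (hp : p.Prime) (hx : IsOneModSq p x) (k : ℕ) : IsOneModSq p (x ^ k) := by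
  induction k with
  | zero => simpa using one hp
  | succ k ih => rw [pow_succ]; exact ih.mul hp hx

theorem prod (hp : p.Prime) {s : Finset ℕ} {f : ℕ → ℚ} (h : ∀ i ∈ s, IsOneModSq p (f i)) :
    IsOneModSq p (∏ i ∈ s, f i) :=
  Finset.prod_induction f (IsOneModSq p) (fun _ _ hx hy => hx.mul hp hy) (one hp) h

theorem of_modEq {a : ℤ} (hp : p.Prime) (h : a ≡ 1 [ZMOD (p : ℤ) ^ 2]) :
    IsOneModSq p a := by
  obtain ⟨c, hc⟩ := h.symm.dvd
  refine ⟨c, 1, fun h => hp.one_lt.ne' (by exact_mod_cast Int.eq_one_of_dvd_one (by positivity) h),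
    ?_⟩
  have : a = 1 + p ^ 2 * c := by linarith
  rw [this]
  push_cast
  ring

theorem pcong_mul (hp : p.Prime) {r : ℕ} (hx : IsOneModSq p x) (z : ℤ) :
    pcong p (r + 2) ((p : ℚ) ^ r * z * x) ((p : ℚ) ^ r * z) := by
  have := Fact.mk hp
  obtain ⟨a, b, hb, rfl⟩ := hx
  have hb0 := intCast_ne_zero_of_not_dvd hb
  have hp0 : (p : ℚ) ≠ 0 := by exact_mod_cast hp.ne_zero
  by_cases hza : z * a = 0
  · left
    have : (z : ℚ) * a = 0 := by exact_mod_cast hza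
    linear_combination (p : ℚ) ^ r * p ^ 2 / b * this
  · right
    have hza' : ((z * a : ℤ) : ℚ) ≠ 0 := by exact_mod_cast hza
    have e : (p : ℚ) ^ r * z * (1 + p ^ 2 * a / b) - p ^ r * z
        = (p : ℚ) ^ (r + 2) * ((z * a : ℤ) : ℚ) / (b : ℚ) := by
      push_cast; ring
    rw [e, padicValRat.div (mul_ne_zero (pow_ne_zero _ hp0) hza') hb0,
      padicValRat.mul (pow_ne_zero _ hp0) hza', padicValRat.pow, padicValRat.self hp.one_lt,
      padicValRat.of_int, padicValRat.of_int, padicValInt.eq_zero_of_not_dvd hb]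
    push_cast
    have : (0 : ℤ) ≤ padicValInt p (z * a) := by positivity
    linarith

end IsOneModSq

theorem prod_range_two_mul (f : ℕ → ℚ) (m : ℕ) :
    ∏ i ∈ range (2 * m), f i = ∏ i ∈ range m, f i * f (2 * m - 1 - i) := by
  rw [prod_mul_distrib, two_mul, prod_range_add, ← prod_range_reflect (fun i => f (m + i))]
  congr 1
  refine prod_congr rfl fun i hi => ?_
  have := mem_range.mp hi
  congr 1
  omega

theorem oddProd_succ (k : ℕ) : oddProd (k + 1) = oddProd k * (2 * k + 1) := by
  simp [oddProd, prod_range_succ]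

theorem oddProd_pos (k : ℕ) : 0 < oddProd k := prod_pos fun _ _ => by positivity

theorem oddProd_add (k l : ℕ) :
    oddProd (k + l) = oddProd k * ∏ i ∈ range l, (2 * (k : ℚ) + 1 + 2 * i) := by
  rw [oddProd, prod_range_add, oddProd]
  congr 1
  refine prod_congr rfl fun i _ => ?_
  push_cast; ring

theorem factorial_two_mul (k : ℕ) :
    ((2 * k).factorial : ℚ) = oddProd k * 2 ^ k * k.factorial := by
  induction k with
  | zero => simp [oddProd]
  | succ k ih =>
    rw [show 2 * (k + 1) = 2 * k + 1 + 1 by ring, Nat.factorial_succ, Nat.factorial_succ,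
      Nat.factorial_succ, oddProd_succ]
    push_cast
    rw [ih]
    ring

theorem oddProd_eq_prod_sub (m : ℕ) :
    oddProd m = ∏ i ∈ range m, (2 * (m : ℚ) + 1 - 2 * (i + 1)) := by
  rw [oddProd, ← prod_range_reflect]
  refine prod_congr rfl fun i hi => ?_
  have := mem_range.mp hi
  rw [Nat.cast_sub (by omega), Nat.cast_sub (by omega)]
  push_cast; ring

theorem factorial_eq_prod (k : ℕ) : (k.factorial : ℚ) = ∏ i ∈ range k, ((i : ℚ) + 1) := by
  rw [← prod_range_add_one_eq_factorial]; push_cast; rfl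

theorem factorial_add (a k : ℕ) :
    ((a + k).factorial : ℚ) = a.factorial * ∏ i ∈ range k, ((a : ℚ) + 1 + i) := by
  rw [← Nat.factorial_mul_ascFactorial, Nat.ascFactorial_eq_prod_range]; push_cast; rfl

theorem factorial_two_mul_eq_prod_sub (m : ℕ) :
    ((2 * m).factorial : ℚ) =
      m.factorial * ∏ i ∈ range m, (2 * (m : ℚ) + 1 - (i + 1)) := by
  rw [two_mul, factorial_add, ← prod_range_reflect]
  congr 1
  refine prod_congr rfl fun i hi => ?_
  have := mem_range.mp hi
  rw [Nat.cast_sub (by omega), Nat.cast_sub (by omega)]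
  push_cast; ring

/-- Pairing opposite factors of the odd numbers in `((c - 1) n, (c + 1) n)`, `n = 2 m + 1`. -/
theorem prod_odd_window (m : ℕ) (c : ℚ) :
    ∏ i ∈ range (2 * m), ((c - 1) * (2 * m + 1) + 2 + 2 * (i : ℚ)) =
      (-1) ^ m * oddProd m ^ 2 *
        ∏ i ∈ range m, (1 - c ^ 2 * ((2 * (m : ℚ) + 1) / (2 * m + 1 - 2 * (i + 1))) ^ 2) := by
  rw [prod_range_two_mul, oddProd_eq_prod_sub, ← prod_pow, ← card_range m, ← prod_const, card_range,
    ← prod_mul_distrib, ← prod_mul_distrib]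
  refine prod_congr rfl fun i hi => ?_
  have := mem_range.mp hi
  have h0 : (2 * (m : ℚ) + 1 - 2 * (i + 1)) ≠ 0 := by
    have : (i : ℚ) + 1 ≤ m := by exact_mod_cast this
    linarith
  rw [Nat.cast_sub (by omega), Nat.cast_sub (by omega)]
  push_cast
  field_simp
  ring

theorem choose_four_mul_add_one (m : ℕ) :
    ((4 * m + 1).choose (2 * m) : ℚ) =
      ∏ i ∈ range m, (1 + 2 * ((2 * (m : ℚ) + 1) / (i + 1) *
        ((2 * (m : ℚ) + 1) / (2 * m + 1 - (i + 1))))) := by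
  rw [Nat.cast_choose ℚ (by omega), show 4 * m + 1 - 2 * m = 2 * m + 1 by omega,
    show 4 * m + 1 = (2 * m + 1) + 2 * m by ring, factorial_add,
    mul_comm ((2 * m).factorial : ℚ), mul_div_mul_left _ _ (by positivity), factorial_eq_prod,
    prod_range_two_mul, prod_range_two_mul, ← prod_div_distrib]
  refine prod_congr rfl fun i hi => ?_
  have := mem_range.mp hi
  have h0 : (2 * (m : ℚ) + 1 - (i + 1)) ≠ 0 := by
    have : (i : ℚ) + 1 ≤ m := by exact_mod_cast this
    linarith
  have h1 : (i : ℚ) + 1 ≠ 0 := by positivity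
  have h2 : ((2 * m - 1 - i : ℕ) : ℚ) = 2 * m - 1 - i := by
    rw [Nat.cast_sub (by omega), Nat.cast_sub (by omega)]; push_cast; ring
  rw [h2]
  have h3 : (2 * (m : ℚ) - 1 - i + 1) ≠ 0 := by convert h0 using 1; ring
  push_cast
  field_simp
  ring

theorem G_eq (m : ℕ) :
    G (2 * m + 1) (m + 1) = (-1) ^ m * 3 * (2 * m + 1) / 4 ^ (9 * m) *
      ((4 * m + 1).choose (2 * m) : ℚ) * 4 ^ m *
      (∏ i ∈ range (2 * m), ((2 - 1) * (2 * m + 1) + 2 + 2 * (i : ℚ))) *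
      (∏ i ∈ range (2 * m), ((4 - 1) * (2 * m + 1) + 2 + 2 * (i : ℚ))) /
      (oddProd m ^ 2 * m.factorial ^ 2) := by
  have hodd : oddProd (5 * m + 2) = oddProd m * (2 * m + 1) *
      (∏ i ∈ range (2 * m), ((2 - 1) * (2 * m + 1) + 2 + 2 * (i : ℚ))) * (3 * (2 * m + 1)) *
      (∏ i ∈ range (2 * m), ((4 - 1) * (2 * m + 1) + 2 + 2 * (i : ℚ))) := by
    rw [show 5 * m + 2 = (m + 1 + 2 * m + 1) + 2 * m by ring, oddProd_add, oddProd_succ,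
      oddProd_add, oddProd_succ]
    push_cast
    congr 1
    · congr 1
      · congr 1
        refine prod_congr rfl fun i _ => ?_
        ring
      · ring
    · refine prod_congr rfl fun i _ => ?_
      ring
  generalize (∏ i ∈ range (2 * m), ((2 - 1) * (2 * m + 1) + 2 + 2 * (i : ℚ))) = S at *
  generalize (∏ i ∈ range (2 * m), ((4 - 1) * (2 * m + 1) + 2 + 2 * (i : ℚ))) = T at *
  unfold G
  rw [show 2 * (2 * m + 1) - 1 + (m + 1) = 5 * m + 2 by omega,
    show 2 * (2 * m + 1) - 1 - (m + 1) = 3 * m by omega,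
    show 2 * (2 * m + 1) - 1 = 4 * m + 1 by omega,
    show 2 * m + 1 - 1 = 2 * m by omega,
    show 5 * (2 * m + 1) - 4 - (m + 1) = 9 * m by omega,
    show 2 * m + 1 + (m + 1) = m + 2 * (m + 1) by ring,
    pow_add, pow_mul (-1 : ℚ) 2]
  generalize ((4 * m + 1).choose (2 * m) : ℚ) = A
  rw [Nat.cast_choose ℚ (show 5 * m + 2 ≤ 2 * (5 * m + 2) by omega),
    Nat.cast_choose ℚ (show 2 * (m + 1) ≤ 5 * m + 2 by omega),
    Nat.cast_choose ℚ (show 2 * m ≤ 3 * m by omega),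
    Nat.cast_choose ℚ (show m + 1 ≤ 2 * (m + 1) by omega),
    show 2 * (5 * m + 2) - (5 * m + 2) = 5 * m + 2 by omega,
    show 5 * m + 2 - 2 * (m + 1) = 3 * m by omega,
    show 3 * m - 2 * m = m by omega,
    show 2 * (m + 1) - (m + 1) = m + 1 by omega,
    factorial_two_mul, factorial_two_mul, factorial_two_mul, hodd, oddProd_succ,
    Nat.factorial_succ m]
  have := (oddProd_pos m).ne'
  have : ((5 * m + 2).factorial : ℚ) ≠ 0 := by positivity
  have : ((3 * m).factorial : ℚ) ≠ 0 := by positivity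
  have : (m.factorial : ℚ) ≠ 0 := by positivity
  have : (m : ℚ) + 1 ≠ 0 := by positivity
  have : 2 * (m : ℚ) + 1 ≠ 0 := by positivity
  rw [show (4 : ℚ) ^ m = 2 ^ m * 2 ^ m by rw [← mul_pow]; norm_num]
  push_cast
  field_simp
  ring

section Morley

variable (m : ℕ)

theorem oddProd_eq_prod_one_sub :
    oddProd m = (-1) ^ m * (2 ^ m * m.factorial) *
      ∏ i ∈ range m, (1 - (2 * (m : ℚ) + 1) / (2 * (i + 1))) := by
  rw [oddProd_eq_prod_sub, factorial_eq_prod]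
  have (x : ℚ) : x ^ m = ∏ i ∈ range m, x := by simp
  rw [this, this, ← prod_mul_distrib, ← prod_mul_distrib, ← prod_mul_distrib]
  refine prod_congr rfl fun i _ => ?_
  have : (i : ℚ) + 1 ≠ 0 := by positivity
  field_simp
  ring

theorem prod_one_sub_eq_four_pow_mul :
    ∏ i ∈ range m, (1 - 2 * ((2 * (m : ℚ) + 1) / (2 * (i + 1)))) =
      4 ^ m * ∏ i ∈ range m, (1 - (2 * (m : ℚ) + 1) / (2 * (i + 1))) := by
  have h := factorial_two_mul m
  have hf : (m.factorial : ℚ) ≠ 0 := by positivity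
  rw [oddProd_eq_prod_one_sub] at h
  have h2 : ((2 * m).factorial : ℚ) = m.factorial * ((-1) ^ m * m.factorial *
      ∏ i ∈ range m, (1 - 2 * ((2 * (m : ℚ) + 1) / (2 * (i + 1))))) := by
    rw [factorial_two_mul_eq_prod_sub]
    congr 1
    rw [factorial_eq_prod]
    have (x : ℚ) : x ^ m = ∏ i ∈ range m, x := by simp
    rw [this, ← prod_mul_distrib, ← prod_mul_distrib]
    refine prod_congr rfl fun i _ => ?_
    have : (i : ℚ) + 1 ≠ 0 := by positivity
    field_simp
    ring
  rw [h2] at h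
  have hc : (m.factorial : ℚ) * ((-1) ^ m * m.factorial) ≠ 0 :=
    mul_ne_zero hf (mul_ne_zero (by simp) hf)
  refine mul_left_cancel₀ hc ?_
  rw [show (4 : ℚ) ^ m = 2 ^ m * 2 ^ m by rw [← mul_pow]; norm_num]
  linear_combination h

end Morley

/-- A form of Morley's congruence modulo `p²`, for `p ^ r = 2 m + 1`. -/
theorem exists_prod_one_sub_mul_eq {p r m : ℕ} (hp : p.Prime) (hm : p ^ r = 2 * m + 1) :
    ∃ w, IsOneModSq p w ∧
      (∏ i ∈ range m, (1 - (2 * (m : ℚ) + 1) / (2 * (i + 1)))) * w = 4 ^ m := by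
  set x : ℕ → ℚ := fun i => (2 * (m : ℚ) + 1) / (2 * (i + 1))
  have hcast : (p : ℚ) ^ r = 2 * m + 1 := by exact_mod_cast hm
  have hmul : ∀ i ∈ range m, IsPMultiple p (x i) := fun i hi => by
    have := mem_range.mp hi
    have := IsPMultiple.pow_div (r := r) (j := 2 * (i + 1)) hp (by omega) (by omega)
    rw [hcast] at this
    push_cast at this
    exact this
  refine ⟨∏ i ∈ range m, (1 + (-1 : ℤ) * (x i / (1 - x i) * (x i / (1 - x i)))),
    .prod hp fun i hi => (hmul i hi).div_one_sub.one_add_mul hp (hmul i hi).div_one_sub _, ?_⟩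
  have hQ : ∏ i ∈ range m, (1 - x i) ≠ 0 :=
    prod_ne_zero_iff.mpr fun i hi => (hmul i hi).one_sub_ne_zero
  refine mul_left_cancel₀ hQ ?_
  rw [mul_comm _ ((4 : ℚ) ^ m), ← prod_one_sub_eq_four_pow_mul, ← prod_mul_distrib,
    ← prod_mul_distrib]
  refine prod_congr rfl fun i hi => ?_
  have := (hmul i hi).one_sub_ne_zero
  change _ = 1 - 2 * x i
  change (1 - x i) * ((1 - x i) * _) = _
  generalize x i = z at *
  push_cast
  field_simp
  ring

theorem isOneModSq_prod_one_sub_sq {p r m : ℕ} (hp : p.Prime) (hm : p ^ r = 2 * m + 1) (c : ℤ) :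
    IsOneModSq p
      (∏ i ∈ range m, (1 - (c : ℚ) ^ 2 * ((2 * (m : ℚ) + 1) / (2 * m + 1 - 2 * (i + 1))) ^ 2)) := by
  have hcast : (p : ℚ) ^ r = 2 * m + 1 := by exact_mod_cast hm
  refine .prod hp fun i hi => ?_
  have := mem_range.mp hi
  have h := IsPMultiple.pow_div (r := r) (j := 2 * m + 1 - 2 * (i + 1)) hp (by omega) (by omega)
  rw [hcast, Nat.cast_sub (by omega)] at h
  push_cast at h
  convert h.one_add_mul hp h (-c ^ 2) using 1
  push_cast
  ring

theorem isOneModSq_choose {p r m : ℕ} (hp : p.Prime) (hm : p ^ r = 2 * m + 1) :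
    IsOneModSq p ((4 * m + 1).choose (2 * m) : ℚ) := by
  have hcast : (p : ℚ) ^ r = 2 * m + 1 := by exact_mod_cast hm
  rw [choose_four_mul_add_one]
  refine .prod hp fun i hi => ?_
  have := mem_range.mp hi
  have h := IsPMultiple.pow_div (r := r) (j := i + 1) hp (by omega) (by omega)
  have h' := IsPMultiple.pow_div (r := r) (j := 2 * m + 1 - (i + 1)) hp (by omega) (by omega)
  rw [hcast] at h h'
  rw [Nat.cast_sub (by omega)] at h'
  push_cast at h h'
  exact_mod_cast h.one_add_mul hp h' 2

theorem exists_G_eq {p r m : ℕ} (hp : p.Prime) (hm : p ^ r = 2 * m + 1) :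
    ∃ u, IsOneModSq p u ∧
      G (2 * m + 1) (m + 1) * (2 ^ (2 * m)) ^ 5 = (-1) ^ m * 3 * (2 * m + 1) * u := by
  obtain ⟨w, hw, hQ⟩ := exists_prod_one_sub_mul_eq hp hm
  have h2 := isOneModSq_prod_one_sub_sq hp hm 2
  have h4 := isOneModSq_prod_one_sub_sq hp hm 4
  refine ⟨_, (isOneModSq_choose hp hm).mul hp ((h2.mul hp h4).mul hp (hw.inv.pow hp 2)), ?_⟩
  rw [G_eq, prod_odd_window, prod_odd_window]
  push_cast
  generalize ((4 * m + 1).choose (2 * m) : ℚ) = A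
  have hD := oddProd_eq_prod_one_sub m
  have hD0 := (oddProd_pos m).ne'
  generalize (∏ i ∈ range m, (1 - (2 * (m : ℚ) + 1) / (2 * (i + 1)))) = Q at *
  generalize (∏ i ∈ range m, (1 - (2 : ℚ) ^ 2 * _)) = V2
  generalize (∏ i ∈ range m, (1 - (4 : ℚ) ^ 2 * _)) = V4
  have hw0 := hw.ne_zero
  have hQ' : Q = 4 ^ m / w := by rw [← hQ]; field_simp
  have hf : (m.factorial : ℚ) ≠ 0 := by positivity
  have hD2 : oddProd m ^ 2 = 4 ^ m * m.factorial ^ 2 * (4 ^ m / w) ^ 2 := by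
    rw [hD, hQ', mul_pow, mul_pow, mul_pow, ← pow_mul, mul_comm m 2, pow_mul, ← pow_mul 2 m 2,
      mul_comm m 2, pow_mul 2 2 m]
    norm_num
  have hs : ((-1 : ℚ) ^ m) ^ 2 = 1 := by rw [← pow_mul, mul_comm, pow_mul]; norm_num
  have h49 : (4 : ℚ) ^ (9 * m) = (4 ^ m) ^ 9 := by rw [mul_comm, pow_mul]
  have h22 : (2 : ℚ) ^ (2 * m) = 4 ^ m := by rw [pow_mul]; norm_num
  rw [h49, h22]
  have hcancel : ∀ X : ℚ, X * ((-1) ^ m * oddProd m ^ 2 * V2) * ((-1) ^ m * oddProd m ^ 2 * V4) /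
      (oddProd m ^ 2 * m.factorial ^ 2) = X * V2 * V4 * oddProd m ^ 2 / m.factorial ^ 2 := by
    intro X
    field_simp
    rw [hs]
    ring
  rw [hcancel, hD2]
  field_simp

theorem isOneModSq_two_pow_sub {p r : ℕ} (hp : p.Prime) (hp2 : 2 < p) (hr : 1 ≤ r) :
    ∃ v, IsOneModSq p v ∧ (2 : ℚ) ^ (p ^ r - 1) = 2 ^ (p - 1) * v := by
  obtain ⟨s, rfl⟩ := Nat.exists_eq_add_of_le' hr
  obtain ⟨t, ht⟩ := Nat.sub_one_dvd_pow_sub_one p s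
  have hc : Nat.Coprime 2 (p ^ 2) :=
    Nat.Coprime.pow_right _ ((Nat.coprime_primes Nat.prime_two hp).mpr hp2.ne)
  have he := (Nat.ModEq.pow_totient hc).pow t
  rw [Nat.totient_prime_pow hp two_pos, one_pow] at he
  refine ⟨((((2 ^ (p ^ (2 - 1) * (p - 1))) ^ t : ℕ) : ℤ) : ℚ), .of_modEq hp ?_, ?_⟩
  · have := Int.natCast_modEq_iff.mpr he
    exact_mod_cast this
  · push_cast
    rw [← pow_mul, ← pow_add]
    congr 1
    have h1 : p ^ s = (p - 1) * t + 1 := by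
      have := Nat.one_le_pow s p hp.pos
      omega
    obtain ⟨q, rfl⟩ := Nat.exists_eq_add_of_le' hp.one_le
    rw [pow_succ, h1]
    simp only [Nat.add_sub_cancel, pow_one]
    rw [Nat.sub_eq_iff_eq_add (Nat.one_le_iff_ne_zero.mpr (by positivity))]
    ring

theorem isOneModSq_fermat {p : ℕ} {y : ℤ} (hp : p.Prime) (hy : (p : ℤ) ∣ y) :
    IsOneModSq p ((1 + y) ^ 5 * (1 - 5 * y)) := by
  obtain ⟨c, rfl⟩ := hy
  have : ((1 + p * c) ^ 5 * (1 - 5 * (p * c)) : ℤ) ≡ 1 [ZMOD (p : ℤ) ^ 2] := by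
    refine (Int.modEq_iff_dvd.mpr ⟨c ^ 2 * (15 + 40 * (p * c) + 45 * (p * c) ^ 2 +
      24 * (p * c) ^ 3 + 5 * (p * c) ^ 4), by ring⟩)
  exact_mod_cast IsOneModSq.of_modEq hp this

theorem stmt_18 (p : ℕ) (hp : p.Prime) (hp3 : 3 < p) (r : ℕ) (hr : 2 ≤ r) :
    pcong p (r + 2) (G (p ^ r) ((p ^ r + 1) / 2))
      ((-1) ^ ((p ^ r - 1) / 2) * 3 * (p : ℚ) ^ r *
        (1 - 5 * p * (((2 : ℚ) ^ (p - 1) - 1) / (p : ℚ)))) := by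
  obtain ⟨m, hm⟩ : Odd (p ^ r) := (hp.odd_of_ne_two (by omega)).pow
  have hcast : (p : ℚ) ^ r = 2 * m + 1 := by exact_mod_cast hm
  have hp0 : (p : ℚ) ≠ 0 := by exact_mod_cast hp.ne_zero
  obtain ⟨u, hu, hG⟩ := exists_G_eq hp hm
  obtain ⟨v, hv, hpow⟩ := isOneModSq_two_pow_sub hp (by omega) (show 1 ≤ r by omega)
  set y : ℤ := 2 ^ (p - 1) - 1 with hy
  have hdvd : (p : ℤ) ∣ y := by
    have hc : IsCoprime (2 : ℤ) p := by
      exact_mod_cast Nat.isCoprime_iff_coprime.mpr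
        ((Nat.coprime_primes Nat.prime_two hp).mpr (by omega))
    exact (Int.ModEq.pow_card_sub_one_eq_one hp hc).symm.dvd
  have hf := isOneModSq_fermat hp hdvd
  have hy' : (2 : ℚ) ^ (p - 1) = 1 + y := by rw [hy]; push_cast; ring
  have hy1 : (1 + y : ℚ) ≠ 0 := by rw [← hy']; positivity
  rw [hm] at hpow ⊢
  rw [Nat.add_sub_cancel] at hpow
  rw [show (2 * m + 1 + 1) / 2 = m + 1 by omega, show (2 * m + 1 - 1) / 2 = m by omega]
  have key := IsOneModSq.pcong_mul hp (r := r)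
    (hu.mul hp ((hv.inv.pow hp 5).mul hp hf.inv)) ((-1) ^ m * 3 * (1 - 5 * y))
  have hv0 := hv.ne_zero
  have hf0 := right_ne_zero_of_mul hf.ne_zero
  convert key using 1
  · rw [hpow, hy'] at hG
    rw [← mul_left_inj' (pow_ne_zero 5 (mul_ne_zero hy1 hv0)), hG, hcast]
    push_cast
    field_simp
  · rw [hy']
    push_cast
    field_simp
    ring
end
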